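/- For every integer n ≥ 0, the coefficient of y^0 in the formal Laurent series y^{−1} · A(−y) · (S_y^n A) is equal to zero, where A(−y) := Σ_{m≥0} (−1)^m a_m u^{−2m} y^{3m}. -/

import Mathlib

noncomputable section

/-- The base field `K = ℂ(u)`, rational functions in the variable `u`. -/
abbrev K : Type := RatFunc ℂ

/-- The variable `u ∈ K`. -/
def u : K := RatFunc.X

/-- The formal derivative `∂_y` of a formal Laurent series in `y` over `K`. -/
def derivLS (f : LaurentSeries K) : LaurentSeries K where
  coeff := fun n => ((n + 1 : ℤ) : K) * f.coeff (n + 1)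
  isPWO_support' := by
    refine ((f.isPWO_support.add (Set.isPWO_singleton (-1 : ℤ))).mono ?_)
    intro n hn
    simp only [Function.mem_support, ne_eq] at hn
    have hf : f.coeff (n + 1) ≠ 0 := fun h => hn (by simp [h])
    rw [Set.add_singleton]
    exact ⟨n + 1, by simpa [HahnSeries.mem_support] using hf, by ring⟩

/-- Multiplication of a formal Laurent series by `y^k`. -/
def ySh (k : ℤ) (f : LaurentSeries K) : LaurentSeries K :=
  (HahnSeries.single k (1 : K)) * f

/-- The operator `S_y f = u⁻² y³ ∂_y f + (1/2) u⁻² y² f + y⁻¹ f`. -/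
def Sy (f : LaurentSeries K) : LaurentSeries K :=
  (u⁻¹ ^ 2) • ySh 3 (derivLS f) + ((1 / 2 : K) * u⁻¹ ^ 2) • ySh 2 f + ySh (-1) f

/-- `a_n = (-1)^n (6n)! / (288^n (2n)! (3n)!)`. -/
def aQ (n : ℕ) : ℚ :=
  (-1) ^ n * ((6 * n).factorial : ℚ) /
    (288 ^ n * ((2 * n).factorial : ℚ) * ((3 * n).factorial : ℚ))

/-- The power-series-in-`y` `Σ_{n ≥ 0} c_n u^{-2n} y^{3n}` (viewed as a Laurent series)
attached to rational coefficients `c : ℕ → ℚ`. -/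
def mkS (c : ℕ → ℚ) : LaurentSeries K :=
  HahnSeries.ofPowerSeries ℤ K
    (PowerSeries.mk fun m => if 3 ∣ m then ((c (m / 3) : ℚ) : K) * u⁻¹ ^ (2 * (m / 3)) else 0)

/-- The series `A = Σ_{n ≥ 0} a_n u^{-2n} y^{3n}`. -/
def A : LaurentSeries K := mkS aQ

/-- `A(-y) = Σ_{m≥0} (-1)^m a_m u^{-2m} y^{3m}`. -/
def Aneg : LaurentSeries K := mkS fun m => (-1) ^ m * aQ m

/-- The Euler operator `y ∂_y` on formal Laurent series. -/
def eulerLS (f : LaurentSeries K) : LaurentSeries K where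
  coeff n := (n : K) * f.coeff n
  isPWO_support' := f.isPWO_support.mono fun n hn => by
    simp only [Function.mem_support, ne_eq] at hn
    exact fun h => hn (by simp [h])

/-- The substitution `y ↦ -y` on formal Laurent series. -/
def reflLS (f : LaurentSeries K) : LaurentSeries K where
  coeff n := (-1) ^ n * f.coeff n
  isPWO_support' := f.isPWO_support.mono fun n hn => by
    simp only [Function.mem_support, ne_eq] at hn
    exact fun h => hn (by simp [h])

@[simp] lemma coeff_eulerLS (f : LaurentSeries K) (n : ℤ) :
    (eulerLS f).coeff n = (n : K) * f.coeff n := rfl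

@[simp] lemma coeff_reflLS (f : LaurentSeries K) (n : ℤ) :
    (reflLS f).coeff n = (-1) ^ n * f.coeff n := rfl

lemma eulerLS_mul (f g : LaurentSeries K) :
    eulerLS (f * g) = eulerLS f * g + f * eulerLS g := by
  ext n
  rw [coeff_eulerLS, HahnSeries.coeff_add, HahnSeries.coeff_mul,
    HahnSeries.coeff_mul_left' f.isPWO_support (fun m hm h => hm (by simp [h])),
    HahnSeries.coeff_mul_right' g.isPWO_support (fun m hm h => hm (by simp [h])),
    Finset.mul_sum, ← Finset.sum_add_distrib]
  refine Finset.sum_congr rfl fun ij hij => ?_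
  rw [← (Finset.mem_antidiagonal.mp hij).2.2]
  simp only [coeff_eulerLS]
  push_cast
  ring

lemma eulerLS_sub (f g : LaurentSeries K) : eulerLS (f - g) = eulerLS f - eulerLS g := by
  ext n
  simp [mul_sub]

lemma reflLS_mul (f g : LaurentSeries K) : reflLS (f * g) = reflLS f * reflLS g := by
  ext n
  rw [coeff_reflLS, HahnSeries.coeff_mul, HahnSeries.coeff_mul, Finset.mul_sum]
  have supp (h : LaurentSeries K) : (reflLS h).support = h.support := by
    ext m
    simp [HahnSeries.mem_support, zpow_ne_zero m (show (-1 : K) ≠ 0 by norm_num)]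
  refine Finset.sum_congr (by simp only [supp]) fun ij hij => ?_
  rw [← (Finset.mem_antidiagonal.mp hij).2.2, coeff_reflLS, coeff_reflLS,
    zpow_add₀ (by norm_num)]
  ring

lemma reflLS_reflLS (f : LaurentSeries K) : reflLS (reflLS f) = f := by
  ext n
  rw [coeff_reflLS, coeff_reflLS, ← mul_assoc, ← mul_zpow]
  simp

lemma Sy_eq (f : LaurentSeries K) :
    Sy f = HahnSeries.single 2 (u⁻¹ ^ 2) * eulerLS f +
      HahnSeries.single 2 (1 / 2 * u⁻¹ ^ 2) * f + HahnSeries.single (-1) 1 * f := by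
  ext n
  simp only [Sy, ySh, HahnSeries.coeff_add, HahnSeries.coeff_smul, HahnSeries.coeff_single_mul,
    coeff_eulerLS, derivLS, smul_eq_mul, one_mul]
  rw [show n - 3 + 1 = n - 2 by ring]

lemma coeff_Sy (f : LaurentSeries K) (n : ℤ) :
    (Sy f).coeff n = u⁻¹ ^ 2 * ((n : K) - 3 / 2) * f.coeff (n - 2) + f.coeff (n + 1) := by
  simp only [Sy_eq, HahnSeries.coeff_add, HahnSeries.coeff_single_mul, coeff_eulerLS, one_mul,
    sub_neg_eq_add]
  push_cast
  ring

lemma reflLS_Sy (f : LaurentSeries K) :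
    reflLS (Sy f) = HahnSeries.single 2 (u⁻¹ ^ 2) * eulerLS (reflLS f) +
      HahnSeries.single 2 (1 / 2 * u⁻¹ ^ 2) * reflLS f -
        HahnSeries.single (-1) 1 * reflLS f := by
  ext n
  simp only [coeff_reflLS, coeff_Sy, HahnSeries.coeff_add, HahnSeries.coeff_sub,
    HahnSeries.coeff_single_mul, coeff_eulerLS, one_mul, sub_neg_eq_add]
  rw [zpow_sub₀ (by norm_num), zpow_add₀ (by norm_num)]
  push_cast
  norm_num
  ring

lemma coeff_mkS_mul_three (c : ℕ → ℚ) (k : ℕ) :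
    (mkS c).coeff (3 * (k : ℤ)) = (c k : K) * u⁻¹ ^ (2 * k) := by
  have h := HahnSeries.ofPowerSeries_apply_coeff (Γ := ℤ) (R := K)
    (PowerSeries.mk fun m => if 3 ∣ m then ((c (m / 3) : ℚ) : K) * u⁻¹ ^ (2 * (m / 3)) else 0)
    (3 * k)
  simpa [mkS] using h

lemma coeff_mkS_eq_zero (c : ℕ → ℚ) (n : ℤ) (h : ∀ k : ℕ, n ≠ 3 * k) :
    (mkS c).coeff n = 0 := by
  rcases lt_or_ge n 0 with hn | hn
  · rw [mkS, HahnSeries.ofPowerSeries_apply, HahnSeries.embDomain_of_notMem_range]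
    rintro ⟨m, hm⟩
    simp at hm
    omega
  · lift n to ℕ using hn
    have h3 : ¬ 3 ∣ n := by
      rintro ⟨k, rfl⟩
      exact h k (by simp)
    simp [mkS, h3]

lemma reflLS_A : reflLS A = Aneg := by
  ext n
  rw [coeff_reflLS, A, Aneg]
  by_cases h : ∃ k : ℕ, n = 3 * k
  · obtain ⟨k, rfl⟩ := h
    rw [coeff_mkS_mul_three, coeff_mkS_mul_three, zpow_mul]
    push_cast
    norm_num
    ring
  · push Not at h
    rw [coeff_mkS_eq_zero _ _ h, coeff_mkS_eq_zero _ _ h, mul_zero]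

lemma aQ_succ (k : ℕ) :
    6 * ((k : ℚ) + 1) * aQ (k + 1) + (3 * k + 5 / 2) * (3 * k + 1 / 2) * aQ k = 0 := by
  have h6 : ((6 * (k + 1)).factorial : ℚ) = (6 * k + 6) * (6 * k + 5) * (6 * k + 4) *
      (6 * k + 3) * (6 * k + 2) * (6 * k + 1) * (6 * k).factorial := by
    rw [show 6 * (k + 1) = 6 * k + 1 + 1 + 1 + 1 + 1 + 1 by ring]
    simp only [Nat.factorial_succ]
    push_cast
    ring
  have h2 : ((2 * (k + 1)).factorial : ℚ) = (2 * k + 2) * (2 * k + 1) * (2 * k).factorial := by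
    rw [show 2 * (k + 1) = 2 * k + 1 + 1 by ring]
    simp only [Nat.factorial_succ]
    push_cast
    ring
  have h3 : ((3 * (k + 1)).factorial : ℚ) =
      (3 * k + 3) * (3 * k + 2) * (3 * k + 1) * (3 * k).factorial := by
    rw [show 3 * (k + 1) = 3 * k + 1 + 1 + 1 by ring]
    simp only [Nat.factorial_succ]
    push_cast
    ring
  have p2 : ((2 * k).factorial : ℚ) ≠ 0 := by positivity
  have p3 : ((3 * k).factorial : ℚ) ≠ 0 := by positivity
  rw [aQ, aQ, h6, h2, h3, pow_succ, pow_succ]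
  field_simp
  ring

lemma coeff_A_recurrence (m : ℤ) :
    2 * (m : K) * A.coeff m +
      u⁻¹ ^ 2 * ((m : K) - 1 / 2) * ((m : K) - 5 / 2) * A.coeff (m - 3) = 0 := by
  by_cases h : ∃ k : ℕ, m = 3 * k
  · obtain ⟨k, rfl⟩ := h
    rcases k with _ | k
    · have h0 : A.coeff (3 * ((0 : ℕ) : ℤ) - 3) = 0 :=
        coeff_mkS_eq_zero _ _ fun k => by omega
      rw [h0]
      simp
    · rw [show 3 * ((k + 1 : ℕ) : ℤ) - 3 = 3 * (k : ℤ) by push_cast; ring, A,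
        coeff_mkS_mul_three, coeff_mkS_mul_three]
      have := congrArg (fun q : ℚ => (q : K)) (aQ_succ k)
      push_cast at this ⊢
      linear_combination u⁻¹ ^ (2 * (k + 1)) * this
  · push Not at h
    rw [A, coeff_mkS_eq_zero _ _ h, coeff_mkS_eq_zero _ _ fun k hk => h (k + 1) (by
      push_cast; omega)]
    simp

/-- The Airy equation for `A`. -/
lemma Sy_Sy_A : Sy (Sy A) = HahnSeries.single (-2) 1 * A := by
  ext n
  simp only [coeff_Sy, HahnSeries.coeff_single_mul, one_mul]
  rw [show n - 2 + 1 = n - 1 by ring, show n + 1 - 2 = n - 1 by ring,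
    show n + 1 + 1 = n - -2 by ring]
  have := coeff_A_recurrence (n - 1)
  rw [show n - 1 - 3 = n - 2 - 2 by ring] at this
  push_cast at this ⊢
  linear_combination u⁻¹ ^ 2 * this

lemma u_ne_zero : u ≠ 0 := RatFunc.X_ne_zero

/-- The Wronskian of `A(y)` and `A(-y)` is a constant multiple of `y⁻¹`. -/
lemma eulerLS_wronskian :
    eulerLS (reflLS A * Sy A - A * reflLS (Sy A)) = -(reflLS A * Sy A - A * reflLS (Sy A)) := by
  have hA := Sy_eq A
  have hC := Sy_eq (Sy A)
  have hB := reflLS_Sy A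
  have hD := reflLS_Sy (Sy A)
  rw [Sy_Sy_A] at hC hD
  have hx : reflLS (HahnSeries.single (-2) 1 * A) = HahnSeries.single (-2) 1 * reflLS A := by
    ext n
    simp only [coeff_reflLS, HahnSeries.coeff_single_mul, one_mul]
    rw [zpow_sub₀ (by norm_num)]
    norm_num
  rw [hx] at hD
  have he : (HahnSeries.single 2 (u⁻¹ ^ 2) : LaurentSeries K) =
      2 * HahnSeries.single 2 (1 / 2 * u⁻¹ ^ 2) := by
    rw [two_mul, ← HahnSeries.single_add]
    congr 1
    ring
  have hne : (HahnSeries.single 2 (u⁻¹ ^ 2) : LaurentSeries K) ≠ 0 := by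
    simp [u_ne_zero]
  apply mul_left_cancel₀ hne
  rw [eulerLS_sub, eulerLS_mul, eulerLS_mul]
  linear_combination (-Sy A) * hB - reflLS A * hC + reflLS (Sy A) * hA + A * hD
    + (reflLS A * Sy A - A * reflLS (Sy A)) * he

lemma coeff_reflLS_A_mul_A (j : ℤ) (hj : Odd j) : (reflLS A * A).coeff j = 0 := by
  have h : (reflLS (reflLS A * A)).coeff j = (reflLS A * A).coeff j := by
    rw [reflLS_mul, reflLS_reflLS, mul_comm]
  rw [coeff_reflLS, hj.neg_one_zpow] at h
  linear_combination (-1 / 2 : K) * h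

lemma coeff_reflLS_A_mul_Sy_A (j : ℤ) (hj : Odd j) (hj0 : 0 < j) :
    (reflLS A * Sy A).coeff j = 0 := by
  have h := congrArg (fun f => f.coeff j) eulerLS_wronskian
  have hr : A * reflLS (Sy A) = reflLS (reflLS A * Sy A) := by
    rw [reflLS_mul, reflLS_reflLS]
  simp only [hr, coeff_eulerLS, HahnSeries.coeff_sub, HahnSeries.coeff_neg, coeff_reflLS,
    hj.neg_one_zpow] at h
  have hne : ((j + 1 : ℤ) : K) * 2 ≠ 0 :=
    mul_ne_zero (Int.cast_ne_zero.mpr (by omega)) two_ne_zero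
  apply mul_left_cancel₀ hne
  push_cast
  linear_combination h

/-- Laurent series involving only the monomials `y ^ (-2 * k)` with `k ≥ 0`. -/
def IsEvenPolar (p : LaurentSeries K) : Prop :=
  ∀ n, p.coeff n ≠ 0 → Even n ∧ n ≤ 0

lemma IsEvenPolar.add {p q : LaurentSeries K} (hp : IsEvenPolar p) (hq : IsEvenPolar q) :
    IsEvenPolar (p + q) := by
  intro n hn
  by_cases h : p.coeff n = 0
  · exact hq n (by simpa [h] using hn)
  · exact hp n h

lemma IsEvenPolar.single_mul {p : LaurentSeries K} (hp : IsEvenPolar p) :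
    IsEvenPolar (HahnSeries.single (-2) 1 * p) := by
  intro n hn
  rw [HahnSeries.coeff_single_mul, one_mul] at hn
  obtain ⟨⟨k, hk⟩, hle⟩ := hp _ hn
  exact ⟨⟨k - 1, by omega⟩, by omega⟩

lemma IsEvenPolar.euler {p : LaurentSeries K} (hp : IsEvenPolar p) :
    IsEvenPolar (HahnSeries.single 2 (u⁻¹ ^ 2) * eulerLS p) := by
  intro n hn
  rw [HahnSeries.coeff_single_mul, coeff_eulerLS] at hn
  have h0 : n - 2 ≠ 0 := fun h => hn (by simp [h])
  obtain ⟨⟨k, hk⟩, hle⟩ := hp _ (right_ne_zero_of_mul (right_ne_zero_of_mul hn))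
  exact ⟨⟨k + 1, by omega⟩, by omega⟩

lemma IsEvenPolar.coeff_mul_one {p f : LaurentSeries K} (hp : IsEvenPolar p)
    (hf : ∀ j, Odd j → 0 < j → f.coeff j = 0) : (p * f).coeff 1 = 0 := by
  rw [HahnSeries.coeff_mul]
  refine Finset.sum_eq_zero fun ij hij => ?_
  obtain ⟨h1, -, hs⟩ := Finset.mem_antidiagonal.mp hij
  obtain ⟨⟨k, hk⟩, hle⟩ := hp _ h1
  rw [hf ij.2 ⟨-k, by omega⟩ (by omega), mul_zero]

lemma exists_iterate_Sy_A (n : ℕ) : ∃ p q : LaurentSeries K,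
    IsEvenPolar p ∧ IsEvenPolar q ∧ Sy^[n] A = p * A + q * Sy A := by
  induction n with
  | zero =>
    refine ⟨1, 0, fun n hn => ?_, fun n hn => by simp at hn, by simp⟩
    have : n = 0 := by
      by_contra h
      simp [HahnSeries.coeff_one, h] at hn
    simp [this]
  | succ n ih =>
    obtain ⟨p, q, hp, hq, h⟩ := ih
    refine ⟨_, _, hp.euler.add hq.single_mul, hp.add hq.euler, ?_⟩
    have hadd : eulerLS (p * A + q * Sy A) = eulerLS (p * A) + eulerLS (q * Sy A) := by
      ext n
      simp [mul_add]
    have hA := Sy_eq A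
    have hC := Sy_eq (Sy A)
    rw [Sy_Sy_A] at hC
    rw [Function.iterate_succ_apply', h, Sy_eq, hadd, eulerLS_mul, eulerLS_mul]
    linear_combination (-p) * hA - q * hC

/-- For every `n ≥ 0`, the coefficient of `y^0` in `y⁻¹ · A(-y) · (S_y^n A)` vanishes. -/
theorem stmt10 (n : ℕ) :
    (ySh (-1) Aneg * Sy^[n] A).coeff 0 = 0 := by
  obtain ⟨p, q, hp, hq, h⟩ := exists_iterate_Sy_A n
  rw [h, ySh, mul_assoc, HahnSeries.coeff_single_mul, ← reflLS_A,
    show reflLS A * (p * A + q * Sy A) = p * (reflLS A * A) + q * (reflLS A * Sy A) by ring]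
  simp only [zero_sub, neg_neg, HahnSeries.coeff_add, one_mul]
  rw [hp.coeff_mul_one fun j hj _ => coeff_reflLS_A_mul_A j hj,
    hq.coeff_mul_one coeff_reflLS_A_mul_Sy_A, add_zero]

end
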